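/- arXiv:1305.4291 — 2 statements merged into one kernel-verified Lean document; each statement's English description precedes it below -/
import Mathlib

section
/- Functional (shift) equation for Faddeev's quantum dilogarithm: for every complex z with |Im z| < Im c_𝖻 − 𝖻/2 (so that both z − i𝖻/2 and z + i𝖻/2 lie in the strip where the defining integral converges), one has Φ_𝖻(z − i𝖻/2) = (1 + e^{2π𝖻z}) · Φ_𝖻(z + i𝖻/2). -/
open Real MeasureTheory

noncomputable section

/-- `c_𝖻 = i(𝖻 + 𝖻⁻¹)/2`. -/
def cB (bb : ℝ) : ℂ := Complex.I * (bb + bb⁻¹) / 2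

/-- The integrand in the definition of Faddeev's quantum dilogarithm. -/
def phiKer (bb : ℝ) (z w : ℂ) : ℂ :=
  Complex.exp (-2 * Complex.I * z * w) /
    (4 * Complex.sinh (w * bb) * Complex.sinh (w / bb) * w)

/-- Faddeev's quantum dilogarithm on the strip `|Im z| < Im c_𝖻`, defined by the
contour integral over `ℝ + iε` with `ε = π·min(𝖻,𝖻⁻¹)/2`. -/
def PhiS (bb : ℝ) (z : ℂ) : ℂ :=
  Complex.exp (∫ t : ℝ, phiKer bb z (t + Complex.I * (π * min bb bb⁻¹ / 2)))

/-- The factor appearing in the functional equation: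
`Φ_𝖻(z) = Efac 𝖻 z · Φ_𝖻(z + i𝖻)`. -/
def Efac (bb : ℝ) (z : ℂ) : ℂ := 1 + Complex.exp (2 * π * bb * (z + Complex.I * bb / 2))

/-- Number of upward shifts by `i𝖻` needed to bring `z` into the strip. -/
def nUp (bb : ℝ) (z : ℂ) : ℕ := ⌊(-((bb + bb⁻¹) / 2) - z.im) / bb⌋₊ + 1

/-- Number of downward shifts by `i𝖻` needed to bring `z` into the strip. -/
def nDn (bb : ℝ) (z : ℂ) : ℕ := ⌊(z.im - (bb + bb⁻¹) / 2) / bb⌋₊ + 1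

/-- Faddeev's quantum dilogarithm `Φ_𝖻`, extended from the strip `|Im z| < Im c_𝖻`
to all of `ℂ` as a meromorphic function by the functional equation
`Φ_𝖻(z - i𝖻/2) = (1 + e^{2π𝖻z}) Φ_𝖻(z + i𝖻/2)`. -/
def Phi (bb : ℝ) (z : ℂ) : ℂ :=
  if z.im ≤ -((bb + bb⁻¹) / 2) then
    (∏ k ∈ Finset.range (nUp bb z), Efac bb (z + Complex.I * k * bb)) *
      PhiS bb (z + Complex.I * (nUp bb z) * bb)
  else if (bb + bb⁻¹) / 2 ≤ z.im then
    PhiS bb (z - Complex.I * (nDn bb z) * bb) /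
      ∏ k ∈ Finset.range (nDn bb z), Efac bb (z - Complex.I * (k + 1) * bb)
  else PhiS bb z


theorem integrable_exp_neg_mul_abs {δ : ℝ} (hδ : 0 < δ) :
    Integrable (fun t : ℝ => Real.exp (-δ * |t|)) := by
  rw [← integrableOn_univ, ← Set.Iic_union_Ioi (a := (0 : ℝ)), integrableOn_union]
  constructor
  · refine (integrableOn_exp_mul_Iic hδ 0).congr_fun (fun t ht => ?_) measurableSet_Iic
    simp only [abs_of_nonpos (Set.mem_Iic.1 ht), neg_mul_neg]
  · refine (exp_neg_integrableOn_Ioi 0 hδ).congr_fun (fun t ht => ?_) measurableSet_Ioi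
    simp only [abs_of_pos (Set.mem_Ioi.1 ht)]

theorem integrable_of_norm_le_exp_neg_mul_abs {f : ℝ → ℂ} (hf : Continuous f) {C δ : ℝ}
    (hδ : 0 < δ) (h : ∀ t, ‖f t‖ ≤ C * Real.exp (-δ * |t|)) : Integrable f :=
  ((integrable_exp_neg_mul_abs hδ).const_mul C).mono' hf.aestronglyMeasurable (.of_forall h)

/-- Contour shift between two horizontal lines, for a function holomorphic on the closed strip
between them and exponentially decaying there. -/
theorem integral_horizontal_eq {f : ℂ → ℂ} {a c C δ : ℝ} (hac : a ≤ c) (hδ : 0 < δ)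
    (hf : ∀ w : ℂ, a ≤ w.im → w.im ≤ c → DifferentiableAt ℂ f w)
    (h : ∀ w : ℂ, a ≤ w.im → w.im ≤ c → ‖f w‖ ≤ C * Real.exp (-δ * |w.re|)) :
    ∫ t : ℝ, f (t + Complex.I * a) = ∫ t : ℝ, f (t + Complex.I * c) := by
  have hintegrable : ∀ y : ℝ, a ≤ y → y ≤ c → Integrable fun t : ℝ => f (t + Complex.I * y) := by
    intro y hay hyc
    refine integrable_of_norm_le_exp_neg_mul_abs (C := C) ?_ hδ fun t => ?_
    · refine continuous_iff_continuousAt.2 fun t => ?_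
      have := (hf (t + Complex.I * y) (by simpa) (by simpa)).continuousAt
      exact ContinuousAt.comp (f := fun t : ℝ => (t + Complex.I * y : ℂ)) this (by fun_prop)
    · simpa using h (t + Complex.I * y) (by simpa) (by simpa)
  have hlim : ∀ y : ℝ, a ≤ y → y ≤ c → Filter.Tendsto
      (fun T : ℝ => ∫ t in -T..T, f (t + Complex.I * y)) Filter.atTop
      (nhds (∫ t : ℝ, f (t + Complex.I * y))) := fun y hay hyc =>
    intervalIntegral_tendsto_integral (hintegrable y hay hyc) Filter.tendsto_neg_atTop_atBot
      Filter.tendsto_id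
  have hside : ∀ s : ℝ, |s| = 1 → Filter.Tendsto
      (fun T : ℝ => ∫ y in a..c, f ((s * T : ℝ) + y * Complex.I)) Filter.atTop (nhds 0) := by
    intro s hs
    refine squeeze_zero_norm' (a := fun T : ℝ => C * Real.exp (-δ * T) * |c - a|) ?_ ?_
    · filter_upwards [Filter.eventually_ge_atTop 0] with T hT
      refine intervalIntegral.norm_integral_le_of_norm_le_const fun y hy => ?_
      rw [Set.uIoc_of_le hac] at hy
      have := h ((s * T : ℝ) + y * Complex.I) (by simpa using hy.1.le) (by simpa using hy.2)
      simpa [abs_mul, hs, abs_of_nonneg hT] using this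
    · have : Filter.Tendsto (fun T : ℝ => Real.exp (-δ * T)) Filter.atTop (nhds 0) :=
        Real.tendsto_exp_atBot.comp
          ((Filter.tendsto_const_mul_atBot_of_neg (neg_lt_zero.2 hδ)).2 Filter.tendsto_id)
      simpa using (this.const_mul C).mul_const |c - a|
  have hrect : ∀ T : ℝ, (∫ t in -T..T, f (t + Complex.I * a)) -
      (∫ t in -T..T, f (t + Complex.I * c)) =
      Complex.I * (∫ y in a..c, f (((-1) * T : ℝ) + y * Complex.I)) -
      Complex.I * (∫ y in a..c, f ((1 * T : ℝ) + y * Complex.I)) := by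
    intro T
    have := Complex.integral_boundary_rect_eq_zero_of_differentiableOn f ⟨-T, a⟩ ⟨T, c⟩ ?_
    · simp only [smul_eq_mul] at this
      simp only [mul_comm Complex.I (_ : ℂ), one_mul, neg_one_mul] at this ⊢
      linear_combination this
    · intro w hw
      rw [Complex.mem_reProdIm, Set.uIcc_of_le hac] at hw
      exact (hf w hw.2.1 hw.2.2).differentiableWithinAt
  have h1 := (hlim a le_rfl hac).sub (hlim c hac le_rfl)
  have h2 := ((hside (-1) (by simp)).const_mul Complex.I).sub
    ((hside 1 (by simp)).const_mul Complex.I)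
  simp only [hrect] at h1
  have := tendsto_nhds_unique h1 h2
  simpa [sub_eq_zero] using this

theorem norm_sinh_ge {w : ℂ} {m : ℝ} (hm : 0 ≤ m) (h : m ≤ Real.sin w.im) :
    m / 2 * Real.exp |w.re| ≤ ‖Complex.sinh w‖ := by
  have him : (Complex.sinh w).im = Real.cosh w.re * Real.sin w.im := by
    conv_lhs => rw [← Complex.re_add_im w, Complex.sinh_add, Complex.sinh_mul_I,
      Complex.cosh_mul_I]
    simp [← Complex.ofReal_sin, ← Complex.ofReal_cos, ← Complex.ofReal_sinh,
      ← Complex.ofReal_cosh]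
  have hcosh : Real.exp |w.re| / 2 ≤ Real.cosh w.re := by
    rw [Real.cosh_eq]
    linarith [Real.exp_abs_le w.re]
  calc m / 2 * Real.exp |w.re| = Real.exp |w.re| / 2 * m := by ring
    _ ≤ Real.cosh w.re * Real.sin w.im := by gcongr
    _ ≤ ‖Complex.sinh w‖ := by
      rw [← him]
      exact (le_abs_self _).trans (Complex.abs_im_le_norm _)

theorem sinh_ne_zero_of_sin_im_pos {w : ℂ} (h : 0 < Real.sin w.im) : Complex.sinh w ≠ 0 := by
  have := norm_sinh_ge h.le le_rfl
  rw [← norm_pos_iff]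
  exact lt_of_lt_of_le (by positivity) this

theorem norm_exp_neg_two_I_mul_le (z w : ℂ) :
    ‖Complex.exp (-2 * Complex.I * z * w)‖ ≤
      Real.exp (2 * z.re * w.im) * Real.exp (2 * |z.im| * |w.re|) := by
  rw [Complex.norm_exp, ← Real.exp_add]
  refine Real.exp_le_exp.2 ?_
  have := le_abs_self (z.im * w.re)
  rw [abs_mul] at this
  simp
  linarith

/-- The Mellin-type integral `∫ e^{us} / (1 + e^u) du = π / sin (π s)`. -/
theorem integral_exp_mul_div_one_add_exp {s : ℂ} (h0 : 0 < s.re) (h1 : s.re < 1) :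
    ∫ u : ℝ, Complex.exp (u * s) / (1 + Complex.exp u) = π / Complex.sin (π * s) := by
  have hbeta : Complex.betaIntegral s (1 - s) = π / Complex.sin (π * s) := by
    have := Complex.Gamma_mul_Gamma_eq_betaIntegral (s := s) (t := 1 - s) h0 (by simpa)
    rw [Complex.Gamma_mul_Gamma_one_sub] at this
    simpa using this.symm
  set x : ℝ → ℝ := fun u => Real.exp u / (1 + Real.exp u) with hx
  have hderiv : ∀ u ∈ Set.univ, HasDerivWithinAt x
      (Real.exp u / (1 + Real.exp u) ^ 2) Set.univ u := by
    intro u _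
    have hpos : (1 + Real.exp u) ≠ 0 := by positivity
    have := (Real.hasDerivAt_exp u).div ((Real.hasDerivAt_exp u).const_add 1) hpos
    exact (this.congr_deriv (by ring)).hasDerivWithinAt
  have hinj : Set.InjOn x Set.univ := by
    intro u _ v _ huv
    have hu : (1 + Real.exp u) ≠ 0 := by positivity
    have hv : (1 + Real.exp v) ≠ 0 := by positivity
    simp only [hx] at huv
    rw [div_eq_div_iff hu hv] at huv
    exact Real.exp_injective (by linarith)
  have himage : x '' Set.univ = Set.Ioo 0 1 := by
    ext y
    simp only [Set.image_univ, Set.mem_range, Set.mem_Ioo, hx]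
    constructor
    · rintro ⟨u, rfl⟩
      refine ⟨by positivity, (div_lt_one (by positivity)).2 (by linarith)⟩
    · rintro ⟨hy0, hy1⟩
      have : 0 < 1 - y := by linarith
      refine ⟨Real.log (y / (1 - y)), ?_⟩
      rw [Real.exp_log (by positivity)]
      field_simp
      ring
  rw [← hbeta, Complex.betaIntegral, intervalIntegral.integral_of_le zero_le_one,
    integral_Ioc_eq_integral_Ioo, ← himage,
    integral_image_eq_integral_abs_deriv_smul MeasurableSet.univ hderiv hinj, setIntegral_univ]
  refine integral_congr_ae (.of_forall fun u => ?_)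
  have hpos : 0 < 1 + Real.exp u := by positivity
  have hne : (1 + Complex.exp u) ≠ 0 := by
    rw [← Complex.ofReal_exp]
    exact_mod_cast hpos.ne'
  have hlog : (1 : ℂ) - (x u : ℂ) = (((1 + Real.exp u)⁻¹ : ℝ) : ℂ) := by
    simp only [hx]
    push_cast
    field_simp
    ring
  have hxlog : (x u : ℂ) = Complex.exp ((u - Real.log (1 + Real.exp u) : ℝ) : ℂ) := by
    rw [← Complex.ofReal_exp, Real.exp_sub, Real.exp_log hpos]
  have hxlog' : (((1 + Real.exp u)⁻¹ : ℝ) : ℂ) =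
      Complex.exp ((- Real.log (1 + Real.exp u) : ℝ) : ℂ) := by
    rw [← Complex.ofReal_exp, Real.exp_neg, Real.exp_log hpos]
  have hcpow : ∀ (r : ℝ) (a : ℂ), Complex.exp (r : ℂ) ^ a = Complex.exp (r * a) := by
    intro r a
    rw [Complex.cpow_def_of_ne_zero (Complex.exp_ne_zero _), Complex.log_exp] <;>
      simp [Real.pi_pos, Real.pi_pos.le]
  have habs : |Real.exp u / (1 + Real.exp u) ^ 2| =
      Real.exp (u - 2 * Real.log (1 + Real.exp u)) := by
    rw [abs_of_pos (by positivity), Real.exp_sub, mul_comm (2 : ℝ), Real.exp_mul,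
      Real.exp_log hpos]
    norm_cast
  have hden : (1 + Complex.exp u)⁻¹ = Complex.exp ((- Real.log (1 + Real.exp u) : ℝ) : ℂ) := by
    rw [← hxlog']
    push_cast
    rfl
  simp only
  rw [hlog, hxlog', hxlog, hcpow, hcpow, habs, Complex.real_smul, Complex.ofReal_exp,
    div_eq_mul_inv, hden, ← Complex.exp_add, ← Complex.exp_add, ← Complex.exp_add]
  congr 1
  push_cast
  ring

theorem norm_exp_div_sinh_le {b m : ℝ} (hb : 0 < b) (hm : 0 < m) (z : ℂ) {w : ℂ}
    (h : m ≤ Real.sin (w.im / b)) :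
    ‖Complex.exp (-2 * Complex.I * z * w) / Complex.sinh (w / b)‖ ≤
      2 / m * Real.exp (2 * z.re * w.im) * Real.exp (-(1 / b - 2 * |z.im|) * |w.re|) := by
  have hs : m / 2 * Real.exp |(w / b).re| ≤ ‖Complex.sinh (w / b)‖ :=
    norm_sinh_ge hm.le (by simpa using h)
  rw [Complex.div_ofReal_re, abs_div, abs_of_pos hb] at hs
  rw [norm_div]
  calc _ ≤ Real.exp (2 * z.re * w.im) * Real.exp (2 * |z.im| * |w.re|) /
        (m / 2 * Real.exp (|w.re| / b)) := by
        gcongr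
        exact norm_exp_neg_two_I_mul_le z w
    _ = _ := by
      have : -(1 / b - 2 * |z.im|) * |w.re| = 2 * |z.im| * |w.re| - |w.re| / b := by ring
      rw [this, Real.exp_sub]
      field_simp

theorem sin_div_pos {b y : ℝ} (hb : 0 < b) (hy : 0 < y) (hyb : y ≤ π * b / 2) :
    0 < Real.sin (y / b) := by
  refine Real.sin_pos_of_pos_of_lt_pi (by positivity) ((div_lt_iff₀ hb).2 ?_)
  nlinarith [mul_pos Real.pi_pos hb]

theorem sinh_div_ne_zero {b y : ℝ} (hb : 0 < b) (hy : 0 < y) (hyb : y ≤ π * b / 2) (t : ℝ) :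
    Complex.sinh ((t + Complex.I * y) / b) ≠ 0 :=
  sinh_ne_zero_of_sin_im_pos (by simpa using sin_div_pos hb hy hyb)

theorem add_I_mul_ne_zero {y : ℝ} (hy : 0 < y) (t : ℝ) : (t + Complex.I * y : ℂ) ≠ 0 := by
  intro h
  simpa [hy.ne'] using congrArg Complex.im h

theorem integral_exp_div_sinh_mid {b : ℝ} (hb : 0 < b) {z : ℂ} (hz : 2 * |z.im| < 1 / b) :
    (1 + Complex.exp (2 * π * b * z)) *
      ∫ t : ℝ, Complex.exp (-2 * Complex.I * z * (t + Complex.I * (π * b / 2 : ℝ))) /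
        Complex.sinh ((t + Complex.I * (π * b / 2 : ℝ)) / b) =
      -Complex.I * (2 * π * b * Complex.exp (2 * π * b * z)) := by
  have hbC : (b : ℂ) ≠ 0 := by exact_mod_cast hb.ne'
  set s : ℂ := 1 / 2 - Complex.I * z * b with hs
  have hre : s.re = 1 / 2 + b * z.im := by simp [hs]; ring
  have habs : |b * z.im| < 1 / 2 := by
    rw [abs_mul, abs_of_pos hb]
    rw [lt_div_iff₀ hb] at hz
    linarith
  rw [abs_lt] at habs
  have h0 : 0 < s.re := by rw [hre]; linarith
  have h1 : s.re < 1 := by rw [hre]; linarith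
  have hcongr : ∀ t : ℝ, Complex.exp (-2 * Complex.I * z * (t + Complex.I * (π * b / 2 : ℝ))) /
        Complex.sinh ((t + Complex.I * (π * b / 2 : ℝ)) / b) =
      -2 * Complex.I * Complex.exp (π * b * z) *
        (fun u : ℝ => Complex.exp (u * s) / (1 + Complex.exp u)) (2 / b * t) := by
    intro t
    have e1 : Complex.exp (-2 * Complex.I * z * (t + Complex.I * (π * b / 2 : ℝ))) =
        Complex.exp (π * b * z) * Complex.exp (-2 * Complex.I * z * t) := by
      rw [← Complex.exp_add]
      congr 1
      push_cast
      linear_combination (-z * π * b) * Complex.I_sq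
    have e2 : ((t : ℂ) + Complex.I * (π * b / 2 : ℝ)) / b = t / b + π / 2 * Complex.I := by
      push_cast
      field_simp
    have e3 : Complex.exp ((2 / b * t : ℝ) * s) =
        Complex.exp (t / b) * Complex.exp (-2 * Complex.I * z * t) := by
      rw [← Complex.exp_add]
      congr 1
      rw [hs]
      push_cast
      field_simp
      ring
    have e4 : Complex.exp ((2 / b * t : ℝ) : ℂ) = Complex.exp (t / b) * Complex.exp (t / b) := by
      rw [← Complex.exp_add]
      congr 1
      push_cast
      ring
    have hne : 1 + Complex.exp (t / b : ℂ) * Complex.exp (t / b) ≠ 0 := by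
      have : 1 + Real.exp (t / b) * Real.exp (t / b) ≠ 0 := by positivity
      exact_mod_cast this
    have hcosh : Complex.cosh (t / b : ℂ) =
        (1 + Complex.exp (t / b : ℂ) * Complex.exp (t / b)) / (2 * Complex.exp (t / b)) := by
      rw [Complex.cosh, Complex.exp_neg]
      field_simp [Complex.exp_ne_zero]
      ring
    simp only
    rw [e1, e2, e3, e4, Complex.sinh_add, Complex.sinh_mul_I, Complex.cosh_mul_I,
      Complex.cos_pi_div_two, Complex.sin_pi_div_two, hcosh]
    have := Complex.exp_ne_zero (t / b : ℂ)
    generalize Complex.exp (t / b : ℂ) = E at *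
    rw [← sq] at hne
    simp only [mul_zero, zero_add, one_mul]
    field_simp
    rw [Complex.I_sq]
    ring
  simp only [hcongr]
  rw [integral_const_mul,
    Measure.integral_comp_mul_left (fun u : ℝ => Complex.exp (u * s) / (1 + Complex.exp u)),
    integral_exp_mul_div_one_add_exp h0 h1, Complex.real_smul]
  have hsin : Complex.sin (π * s) ≠ 0 := by
    rw [Complex.sin_ne_zero_iff]
    intro k hk
    have hpi : (π : ℂ) ≠ 0 := by exact_mod_cast Real.pi_ne_zero
    have hsk : s = k := by
      apply mul_left_cancel₀ hpi
      rw [hk, mul_comm]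
    rw [hsk, Complex.intCast_re] at h0 h1
    have h0' : 0 < k := by exact_mod_cast h0
    have h1' : k < 1 := by exact_mod_cast h1
    omega
  have hsin' : Complex.sin (π * s) = Complex.cosh (π * b * z) := by
    have : (π * s : ℂ) = π / 2 - π * b * z * Complex.I := by rw [hs]; ring
    rw [this, Complex.sin_pi_div_two_sub, Complex.cos_mul_I]
  have hq : Complex.exp (2 * π * b * z) = Complex.exp (π * b * z) * Complex.exp (π * b * z) := by
    rw [← Complex.exp_add]
    congr 1
    ring
  have hq' : 1 + Complex.exp (2 * π * b * z) =
      2 * Complex.exp (π * b * z) * Complex.cosh (π * b * z) := by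
    rw [hq, Complex.cosh, Complex.exp_neg]
    field_simp [Complex.exp_ne_zero]
    ring
  rw [hsin'] at hsin ⊢
  rw [hq', hq, inv_div, abs_of_pos (by positivity)]
  push_cast
  field_simp

theorem integral_exp_div_sinh {b y : ℝ} (hb : 0 < b) (hy : 0 < y) (hyb : y ≤ π * b / 2) {z : ℂ}
    (hz : 2 * |z.im| < 1 / b) :
    (1 + Complex.exp (2 * π * b * z)) *
      ∫ t : ℝ, Complex.exp (-2 * Complex.I * z * (t + Complex.I * y)) /
        Complex.sinh ((t + Complex.I * y) / b) =
      -Complex.I * (2 * π * b * Complex.exp (2 * π * b * z)) := by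
  have hsin : ∀ v, y ≤ v → v ≤ π * b / 2 → Real.sin (y / b) ≤ Real.sin (v / b) := by
    intro v hv hvb
    have h1 : 0 < y / b := by positivity
    have h2 : v / b ≤ π / 2 := (div_le_iff₀ hb).2 (by linarith)
    refine Real.sin_le_sin_of_le_of_le_pi_div_two (by linarith [Real.pi_pos]) h2 (by gcongr)
  have hm := sin_div_pos hb hy hyb
  rw [← integral_exp_div_sinh_mid hb hz]
  congr 1
  refine integral_horizontal_eq
    (f := fun w => Complex.exp (-2 * Complex.I * z * w) / Complex.sinh (w / b))
    (C := 2 / Real.sin (y / b) * Real.exp (2 * |z.re| * (π * b / 2)))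
    (δ := 1 / b - 2 * |z.im|) hyb (by linarith) (fun w h1 h2 => ?_) fun w h1 h2 => ?_
  · have : Complex.sinh (w / b) ≠ 0 :=
      sinh_ne_zero_of_sin_im_pos (by simpa using hm.trans_le (hsin _ h1 h2))
    have h3 : DifferentiableAt ℂ (fun w => Complex.sinh (w / b)) w :=
      Complex.differentiable_sinh.differentiableAt.comp w (by fun_prop)
    exact DifferentiableAt.div (by fun_prop) h3 this
  · refine (norm_exp_div_sinh_le hb hm z (hsin _ h1 h2)).trans ?_
    have : z.re * w.im ≤ |z.re| * (π * b / 2) :=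
      mul_le_mul (le_abs_self _) h2 (hy.le.trans h1) (abs_nonneg _)
    gcongr ?_ * Real.exp ?_ * _
    linarith

theorem continuous_exp_div_sinh {b y : ℝ} (hb : 0 < b) (hy : 0 < y) (hyb : y ≤ π * b / 2) (z : ℂ) :
    Continuous fun t : ℝ => Complex.exp (-2 * Complex.I * z * (t + Complex.I * y)) /
      Complex.sinh ((t + Complex.I * y) / b) :=
  Continuous.div (by fun_prop) (Complex.continuous_sinh.comp (by fun_prop))
    (sinh_div_ne_zero hb hy hyb)

theorem continuous_exp_div_sinh_mul {b y : ℝ} (hb : 0 < b) (hy : 0 < y) (hyb : y ≤ π * b / 2)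
    (z : ℂ) :
    Continuous fun t : ℝ => -(Complex.exp (-2 * Complex.I * z * (t + Complex.I * y)) /
      Complex.sinh ((t + Complex.I * y) / b)) / (2 * (t + Complex.I * y)) :=
  (continuous_exp_div_sinh hb hy hyb z).neg.div (by fun_prop)
    fun t => mul_ne_zero two_ne_zero (add_I_mul_ne_zero hy t)

theorem norm_exp_div_sinh_mul_le {b y : ℝ} (hb : 0 < b) (hy : 0 < y) (hyb : y ≤ π * b / 2)
    (z : ℂ) (t : ℝ) :
    ‖-(Complex.exp (-2 * Complex.I * z * (t + Complex.I * y)) /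
      Complex.sinh ((t + Complex.I * y) / b)) / (2 * (t + Complex.I * y))‖ ≤
      1 / (y * Real.sin (y / b)) * Real.exp (2 * z.re * y) *
        Real.exp (-(1 / b - 2 * |z.im|) * |t|) := by
  have hm := sin_div_pos hb hy hyb
  have h1 := norm_exp_div_sinh_le (w := t + Complex.I * y) hb hm z (by simp)
  have h2 : y ≤ ‖(t + Complex.I * y : ℂ)‖ := by
    simpa using (le_abs_self _).trans (Complex.abs_im_le_norm (t + Complex.I * y : ℂ))
  simp only [Complex.add_im, Complex.ofReal_im, Complex.mul_im, Complex.I_re, Complex.I_im,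
    Complex.ofReal_re, Complex.add_re, Complex.mul_re, zero_mul, one_mul, zero_add,
    mul_zero, sub_zero, add_zero] at h1
  rw [norm_div, norm_neg, norm_mul, Complex.norm_ofNat]
  calc _ ≤ 2 / Real.sin (y / b) * Real.exp (2 * z.re * y) *
        Real.exp (-(1 / b - 2 * |z.im|) * |t|) / (2 * y) := by gcongr
    _ = _ := by field_simp

theorem exp_integral_exp_div_sinh_mul {b y : ℝ} (hb : 0 < b) (hy : 0 < y) (hyb : y ≤ π * b / 2)
    {z : ℂ} (hz : 2 * |z.im| < 1 / b) :
    Complex.exp (∫ t : ℝ, -(Complex.exp (-2 * Complex.I * z * (t + Complex.I * y)) /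
      Complex.sinh ((t + Complex.I * y) / b)) / (2 * (t + Complex.I * y))) =
      1 + Complex.exp (2 * π * b * z) := by
  have hm := sin_div_pos hb hy hyb
  have hδ : 0 < 1 / b - 2 * |z.im| := by linarith
  set F : ℝ → ℝ → ℂ := fun s t =>
    -(Complex.exp (-2 * Complex.I * (z + s) * (t + Complex.I * y)) /
      Complex.sinh ((t + Complex.I * y) / b)) / (2 * (t + Complex.I * y)) with hF
  set F' : ℝ → ℝ → ℂ := fun s t =>
    Complex.I * (Complex.exp (-2 * Complex.I * (z + s) * (t + Complex.I * y)) /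
      Complex.sinh ((t + Complex.I * y) / b)) with hF'
  have hFint : ∀ s, Integrable (F s) := fun s =>
    integrable_of_norm_le_exp_neg_mul_abs (continuous_exp_div_sinh_mul hb hy hyb _)
      (by simpa using hδ) (norm_exp_div_sinh_mul_le hb hy hyb (z + s))
  have hderiv : ∀ s, HasDerivAt (fun s => ∫ t, F s t) (∫ t, F' s t) s := by
    intro s
    refine (hasDerivAt_integral_of_dominated_loc_of_deriv_le (s := Set.Iio (s + 1))
      (bound := fun t => 2 / Real.sin (y / b) * Real.exp (2 * (z.re + (s + 1)) * y) *
        Real.exp (-(1 / b - 2 * |z.im|) * |t|))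
      (Iio_mem_nhds (by linarith)) (.of_forall fun s => (hFint s).aestronglyMeasurable) (hFint s)
      ((continuous_exp_div_sinh hb hy hyb _).const_mul _).aestronglyMeasurable
      (.of_forall fun t r hr => ?_) ((integrable_exp_neg_mul_abs hδ).const_mul _)
      (.of_forall fun t r _ => ?_)).2
    · have h1 := norm_exp_div_sinh_le (w := t + Complex.I * y) hb hm (z + r) (by simp)
      simp only [hF', norm_mul, Complex.norm_I, one_mul]
      refine h1.trans ?_
      simp only [Complex.add_re, Complex.add_im, Complex.mul_re, Complex.mul_im, Complex.I_re,
        Complex.I_im, Complex.ofReal_re, Complex.ofReal_im, zero_mul, one_mul, zero_add,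
        mul_zero, sub_zero, add_zero]
      gcongr
      exact (Set.mem_Iio.1 hr).le
    · have hw := add_I_mul_ne_zero hy t
      have hsinh := sinh_div_ne_zero hb hy hyb t
      have h1 : HasDerivAt (fun r : ℝ => -2 * Complex.I * (z + r) * (t + Complex.I * y))
          (-2 * Complex.I * (t + Complex.I * y)) r := by
        have := (((Complex.ofRealCLM.hasDerivAt (x := r)).const_add z).const_mul
          (-2 * Complex.I)).mul_const (t + Complex.I * y : ℂ)
        simpa using this
      have h2 := ((h1.cexp.div_const (Complex.sinh ((t + Complex.I * y) / b))).neg.div_const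
        (2 * (t + Complex.I * y) : ℂ))
      refine h2.congr_deriv ?_
      simp only [hF']
      field_simp
  have hlim : Filter.Tendsto (fun s => ∫ t, F s t) Filter.atBot (nhds 0) := by
    refine squeeze_zero_norm (a := fun s => Real.exp (s * (2 * y)) *
      ∫ t : ℝ, 1 / (y * Real.sin (y / b)) * Real.exp (2 * z.re * y) *
        Real.exp (-(1 / b - 2 * |z.im|) * |t|)) (fun s => ?_) ?_
    · rw [← integral_const_mul]
      refine norm_integral_le_of_norm_le (((integrable_exp_neg_mul_abs hδ).const_mul _).const_mul _)
        (.of_forall fun t => ?_)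
      refine (norm_exp_div_sinh_mul_le hb hy hyb (z + s) t).trans_eq ?_
      have : 2 * (z + s).re * y = s * (2 * y) + 2 * z.re * y := by simp; ring
      rw [this, Real.exp_add]
      simp
      ring
    · have : Filter.Tendsto (fun s => Real.exp (s * (2 * y))) Filter.atBot (nhds 0) :=
        Real.tendsto_exp_atBot.comp (Filter.tendsto_id.atBot_mul_const (by positivity))
      simpa using this.mul_const _
  set G : ℝ → ℂ := fun s =>
    Complex.exp (-∫ t, F s t) * (1 + Complex.exp (2 * π * b * (z + s))) with hG
  have hGderiv : ∀ s, HasDerivAt G 0 s := by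
    intro s
    have h1 : HasDerivAt (fun r : ℝ => 2 * π * b * (z + r) : ℝ → ℂ) (2 * π * b) s := by
      simpa using ((Complex.ofRealCLM.hasDerivAt (x := s)).const_add z).const_mul (2 * π * b : ℂ)
    refine ((hderiv s).neg.cexp.mul (h1.cexp.const_add 1)).congr_deriv ?_
    have h2 := integral_exp_div_sinh hb hy hyb (z := z + s) (by simpa using hz)
    simp only [hF', integral_const_mul]
    linear_combination (-Complex.exp (-∫ t, F s t) * Complex.I) * h2 +
      Complex.exp (-∫ t, F s t) * (2 * π * b * Complex.exp (2 * π * b * (z + s))) * Complex.I_sq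
  have hGconst : ∀ s, G s = G 0 := fun s =>
    is_const_of_deriv_eq_zero (fun s => (hGderiv s).differentiableAt)
      (fun s => (hGderiv s).deriv) s 0
  have hexp : Filter.Tendsto (fun s : ℝ => Complex.exp (2 * π * b * (z + s))) Filter.atBot
      (nhds 0) := by
    refine squeeze_zero_norm (a := fun s => Real.exp (2 * π * b * z.re + s * (2 * π * b)))
      (fun s => ?_) ?_
    · rw [Complex.norm_exp]
      refine Real.exp_le_exp.2 (le_of_eq ?_)
      simp
      ring
    · exact Real.tendsto_exp_atBot.comp (Filter.tendsto_atBot_add_const_left _ _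
        (Filter.tendsto_id.atBot_mul_const (by positivity)))
  have hGlim : Filter.Tendsto G Filter.atBot (nhds 1) := by
    simpa using ((Complex.continuous_exp.tendsto _).comp hlim.neg).mul (hexp.const_add 1)
  have hG0 : G 0 = 1 := by
    rw [funext hGconst] at hGlim
    exact tendsto_nhds_unique tendsto_const_nhds hGlim
  simp only [hG, hF, Complex.ofReal_zero, add_zero, Complex.exp_neg] at hG0
  exact ((inv_mul_eq_one₀ (Complex.exp_ne_zero _)).1 hG0)

theorem integrable_phiKer {b y : ℝ} (hb : 0 < b) (hy : 0 < y) (hyb : y ≤ π * b / 2)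
    (hyb' : y ≤ π * b⁻¹ / 2) {z : ℂ} (hz : |z.im| < (b + b⁻¹) / 2) :
    Integrable fun t : ℝ => phiKer b z (t + Complex.I * y) := by
  have hm := sin_div_pos hb hy hyb
  have hm' : 0 < Real.sin (y * b) := by simpa using sin_div_pos (inv_pos.2 hb) hy hyb'
  have hne : ∀ t : ℝ, Complex.sinh ((t + Complex.I * y) * b) ≠ 0 := fun t => by
    simpa using sinh_div_ne_zero (inv_pos.2 hb) hy hyb' t
  refine integrable_of_norm_le_exp_neg_mul_abs (δ := b + b⁻¹ - 2 * |z.im|)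
    (C := Real.exp (2 * z.re * y) / (Real.sin (y * b) * Real.sin (y / b) * y))
    ?_ (by linarith) fun t => ?_
  · refine Continuous.div (by fun_prop) ?_ fun t => ?_
    · exact ((continuous_const.mul (Complex.continuous_sinh.comp (by fun_prop))).mul
        (Complex.continuous_sinh.comp (by fun_prop))).mul (by fun_prop)
    · exact mul_ne_zero (mul_ne_zero (mul_ne_zero (by norm_num) (hne t))
        (sinh_div_ne_zero hb hy hyb t)) (add_I_mul_ne_zero hy t)
  · have h1 := norm_exp_neg_two_I_mul_le z (t + Complex.I * y)
    have h2 : Real.sin (y * b) / 2 * Real.exp (|t| * b) ≤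
        ‖Complex.sinh ((t + Complex.I * y) * b)‖ := by
      simpa [abs_mul, abs_of_pos hb] using
        norm_sinh_ge (w := (t + Complex.I * y) * b) hm'.le (by simp)
    have h3 : Real.sin (y / b) / 2 * Real.exp (|t| / b) ≤
        ‖Complex.sinh ((t + Complex.I * y) / b)‖ := by
      simpa [abs_div, abs_of_pos hb] using
        norm_sinh_ge (w := (t + Complex.I * y) / b) hm.le (by simp)
    have h4 : y ≤ ‖(t + Complex.I * y : ℂ)‖ := by
      simpa using (le_abs_self _).trans (Complex.abs_im_le_norm (t + Complex.I * y : ℂ))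
    simp only [Complex.add_im, Complex.ofReal_im, Complex.mul_im, Complex.I_re, Complex.I_im,
      Complex.ofReal_re, Complex.add_re, Complex.mul_re, zero_mul, one_mul, zero_add,
      mul_zero, sub_zero, add_zero] at h1
    rw [phiKer, norm_div, norm_mul, norm_mul, norm_mul, Complex.norm_ofNat]
    calc _ ≤ Real.exp (2 * z.re * y) * Real.exp (2 * |z.im| * |t|) /
          (4 * (Real.sin (y * b) / 2 * Real.exp (|t| * b)) *
            (Real.sin (y / b) / 2 * Real.exp (|t| / b)) * y) := by gcongr
      _ = _ := by
        have : -(b + b⁻¹ - 2 * |z.im|) * |t| = 2 * |z.im| * |t| - |t| * b - |t| / b := by ring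
        rw [this, Real.exp_sub, Real.exp_sub]
        field_simp
        ring

theorem phiKer_sub_eq {b y : ℝ} (hb : 0 < b) (hy : 0 < y) (hyb' : y ≤ π * b⁻¹ / 2) (z : ℂ)
    (t : ℝ) :
    phiKer b (z - Complex.I * b / 2) (t + Complex.I * y) -
      phiKer b (z + Complex.I * b / 2) (t + Complex.I * y) =
      -(Complex.exp (-2 * Complex.I * z * (t + Complex.I * y)) /
        Complex.sinh ((t + Complex.I * y) / b)) / (2 * (t + Complex.I * y)) := by
  have hne : Complex.sinh ((t + Complex.I * y) * b) ≠ 0 := by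
    simpa using sinh_div_ne_zero (inv_pos.2 hb) hy hyb' t
  set w : ℂ := t + Complex.I * y
  have e1 : Complex.exp (-2 * Complex.I * (z - Complex.I * b / 2) * w) =
      Complex.exp (-2 * Complex.I * z * w) * Complex.exp (-(w * b)) := by
    rw [← Complex.exp_add]
    congr 1
    linear_combination (b * w) * Complex.I_sq
  have e2 : Complex.exp (-2 * Complex.I * (z + Complex.I * b / 2) * w) =
      Complex.exp (-2 * Complex.I * z * w) * Complex.exp (w * b) := by
    rw [← Complex.exp_add]
    congr 1
    linear_combination (-(b * w)) * Complex.I_sq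
  have e3 : Complex.exp (-(w * b)) - Complex.exp (w * b) = -2 * Complex.sinh (w * b) := by
    rw [Complex.sinh]
    ring
  rw [phiKer, phiKer, e1, e2, ← sub_div, ← mul_sub, e3]
  generalize Complex.sinh (w / b) = S
  by_cases hS : S = 0
  · simp [hS]
  have hw : w ≠ 0 := add_I_mul_ne_zero hy t
  field_simp
  ring

theorem PhiS_shift {b : ℝ} (hb : 0 < b) {z : ℂ} (hz : |z.im| < b⁻¹ / 2) :
    PhiS b (z - Complex.I * b / 2) =
      (1 + Complex.exp (2 * π * b * z)) * PhiS b (z + Complex.I * b / 2) := by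
  have hb' : 0 < b⁻¹ := inv_pos.2 hb
  have hy : 0 < π * min b b⁻¹ / 2 := by have := lt_min hb hb'; positivity
  have hyb : π * min b b⁻¹ / 2 ≤ π * b / 2 := by gcongr; exact min_le_left _ _
  have hyb' : π * min b b⁻¹ / 2 ≤ π * b⁻¹ / 2 := by gcongr; exact min_le_right _ _
  have hcast : (π * (min b b⁻¹ : ℝ) / 2 : ℂ) = ((π * min b b⁻¹ / 2 : ℝ) : ℂ) := by
    push_cast
    rfl
  have hz' := abs_lt.1 hz
  simp only [PhiS, hcast]
  generalize π * min b b⁻¹ / 2 = y at *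
  rw [← exp_integral_exp_div_sinh_mul hb hy hyb (by rw [one_div]; linarith), ← Complex.exp_add]
  simp only [← phiKer_sub_eq hb hy hyb']
  rw [integral_sub, sub_add_cancel] <;>
    refine integrable_phiKer hb hy hyb hyb' (abs_lt.2 ?_) <;>
    simp <;> constructor <;> linarith

/-- The functional (shift) equation for Faddeev's quantum dilogarithm:
`Φ_𝖻(z - i𝖻/2) = (1 + e^{2π𝖻z}) Φ_𝖻(z + i𝖻/2)` for `|Im z| < Im c_𝖻 - 𝖻/2`. -/
theorem Phi_shift (bb : ℝ) (hbb : 0 < bb) (z : ℂ) (hz : |z.im| < (cB bb).im - bb / 2) :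
    Phi bb (z - Complex.I * bb / 2) =
      (1 + Complex.exp (2 * π * bb * z)) * Phi bb (z + Complex.I * bb / 2) := by
  have hc : (cB bb).im = (bb + bb⁻¹) / 2 := by simp [cB]
  have hz' : |z.im| < bb⁻¹ / 2 := by rw [hc] at hz; linarith
  have hin := abs_lt.1 hz'
  have him : (z - Complex.I * bb / 2).im = z.im - bb / 2 := by simp
  have him' : (z + Complex.I * bb / 2).im = z.im + bb / 2 := by simp
  rw [Phi, Phi, him, him', if_neg (by linarith), if_neg (by linarith), if_neg (by linarith),
    if_neg (by linarith)]
  exact PhiS_shift hbb hz'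
end
end

section
/- Quasi-classical limit of Faddeev's quantum dilogarithm: for every fixed real x, one has Φ_𝖻(x/(2π𝖻)) = exp( Li₂(−eˣ)/(2πi𝖻²) ) · (1 + O(𝖻²)) as 𝖻 → 0⁺; that is, there exist constants C > 0 and δ > 0 (depending on x) such that for all 0 < 𝖻 < δ, |Φ_𝖻(x/(2π𝖻)) · exp( −Li₂(−eˣ)/(2πi𝖻²) ) − 1| ≤ C𝖻². -/
open Real MeasureTheory

noncomputable section

/-- `Li₂(-eˣ) = -∫_{-∞}^x log(1 + eᵗ) dt` for real `x`. -/
def Li2negExp (x : ℝ) : ℝ := -∫ t in Set.Iic x, Real.log (1 + Real.exp t)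

lemma inv_cosh_le (t : ℝ) : (cosh t)⁻¹ ≤ 2 * (1 + t ^ 2)⁻¹ := by
  have hs : (t / 2) ^ 2 ≤ sinh (t / 2) ^ 2 := by
    rw [sq_le_sq, abs_sinh]
    exact self_le_sinh_iff.2 (abs_nonneg _)
  have hc : (1 + t ^ 2) / 2 ≤ cosh t := by
    have h2 := cosh_two_mul (t / 2)
    rw [mul_div_cancel₀ t (two_ne_zero), cosh_sq] at h2
    linarith
  rw [← div_eq_mul_inv, inv_eq_one_div, div_le_div_iff₀ (cosh_pos t) (by positivity)]
  linarith

lemma integrable_inv_cosh : Integrable fun t : ℝ ↦ (cosh t)⁻¹ := by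
  refine (integrable_inv_one_add_sq.const_mul 2).mono' ?_ (.of_forall fun t ↦ ?_)
  · exact (continuous_cosh.inv₀ fun t ↦ (cosh_pos t).ne').aestronglyMeasurable
  · rw [norm_of_nonneg (by positivity [cosh_pos t])]
    exact inv_cosh_le t

lemma Complex.norm_le_two_mul_norm_sinh {u : ℂ} (hu : |u.im| ≤ π / 2) :
    ‖u‖ ≤ 2 * ‖Complex.sinh u‖ := by
  have hsq : ‖Complex.sinh u‖ ^ 2 = Real.sinh u.re ^ 2 + Real.sin u.im ^ 2 := by
    conv_lhs => rw [← Complex.re_add_im u, Complex.sinh_add, Complex.sinh_mul_I, Complex.cosh_mul_I,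
      ← Complex.ofReal_sinh, ← Complex.ofReal_cosh, ← Complex.ofReal_sin, ← Complex.ofReal_cos,
      ← mul_assoc, ← Complex.ofReal_mul, ← Complex.ofReal_mul, Complex.sq_norm,
      Complex.normSq_add_mul_I, mul_pow, mul_pow, Real.cosh_sq, Real.cos_sq']
    ring
  have h1 : u.re ^ 2 ≤ Real.sinh u.re ^ 2 := by
    rw [sq_le_sq, Real.abs_sinh]
    exact Real.self_le_sinh_iff.2 (abs_nonneg _)
  have h2 : u.im ^ 2 ≤ 4 * Real.sin u.im ^ 2 := by
    have h := Real.mul_abs_le_abs_sin hu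
    have h3 : (1 / 2 : ℝ) ≤ 2 / π := by
      rw [div_le_div_iff₀ two_pos pi_pos]; linarith [Real.pi_le_four]
    have h4 : |u.im| ≤ |2 * Real.sin u.im| := by
      rw [abs_mul, abs_two]
      nlinarith [abs_nonneg u.im]
    have := sq_le_sq.2 h4
    linarith
  have h5 : ‖u‖ ^ 2 ≤ (2 * ‖Complex.sinh u‖) ^ 2 := by
    rw [mul_pow, hsq, Complex.sq_norm, Complex.normSq_apply]
    nlinarith [sq_nonneg u.re]
  exact le_of_sq_le_sq h5 (by positivity)

lemma Complex.norm_sinh_sub_self_le {u : ℂ} (hu : ‖u‖ ≤ 1) :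
    ‖Complex.sinh u - u‖ ≤ ‖u‖ ^ 3 := by
  have h1 := Complex.exp_bound hu (n := 3) (by norm_num)
  have h2 := Complex.exp_bound (x := -u) (by simpa using hu) (n := 3) (by norm_num)
  simp only [Finset.sum_range_succ, Finset.sum_range_zero, Nat.factorial, norm_neg] at h1 h2
  rw [show Complex.sinh u - u = ((Complex.exp u - _) - (Complex.exp (-u) - _)) / 2 from ?_,
    norm_div, Complex.norm_ofNat]
  · have := (norm_sub_le _ _).trans (add_le_add h1 h2)
    rw [div_le_iff₀ two_pos]
    refine this.trans ?_
    norm_num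
    nlinarith [pow_nonneg (norm_nonneg u) 3]
  · rw [Complex.sinh]
    push_cast
    ring

lemma Complex.norm_inv_sinh_sub_inv_le {u : ℂ} (hu0 : u ≠ 0) (hu : |u.im| ≤ π / 2) :
    ‖(Complex.sinh u)⁻¹ - u⁻¹‖ ≤ 3 * ‖u‖ := by
  have hn : 0 < ‖u‖ := norm_pos_iff.2 hu0
  have h := Complex.norm_le_two_mul_norm_sinh hu
  have hs : 0 < ‖Complex.sinh u‖ := by linarith
  have hs0 : Complex.sinh u ≠ 0 := norm_pos_iff.1 hs
  rcases le_total ‖u‖ 1 with h1 | h1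
  · rw [inv_sub_inv hs0 hu0, norm_div, norm_mul, norm_sub_rev, div_le_iff₀ (by positivity)]
    have h3 := Complex.norm_sinh_sub_self_le h1
    have h4 : ‖u‖ ^ 2 * ‖u‖ ≤ ‖u‖ ^ 2 * (2 * ‖Complex.sinh u‖) := by gcongr
    nlinarith [mul_pos (pow_pos hn 2) hs]
  · refine (norm_sub_le _ _).trans ?_
    rw [norm_inv, norm_inv]
    have h2 : ‖u‖⁻¹ ≤ 1 := inv_le_one_of_one_le₀ h1
    have h3 : ‖Complex.sinh u‖⁻¹ ≤ 2 := by
      rw [inv_le_comm₀ hs two_pos]; linarith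
    linarith

lemma sigmoid_two_mul (t : ℝ) : sigmoid (2 * t) = exp (t - log (2 * cosh t)) := by
  have hc : 0 < 2 * cosh t := by positivity [cosh_pos t]
  rw [exp_sub, exp_log hc, sigmoid_def, cosh_eq, show -(2 * t) = -t + -t by ring, exp_add, exp_neg]
  field_simp

lemma integral_exp_mul_inv_cosh {c : ℂ} (hc : |c.re| < 1) :
    ∫ t : ℝ, Complex.exp (c * t) * ((cosh t)⁻¹ : ℝ) = π / Complex.cos (π * c / 2) := by
  obtain ⟨hc₁, hc₂⟩ := abs_lt.1 hc
  set u : ℂ := (1 + c) / 2 with hu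
  have hre : u.re = (1 + c.re) / 2 := by simp [hu]
  have hbeta : Complex.betaIntegral u (1 - u) = π / Complex.cos (π * c / 2) := by
    have h := Complex.Gamma_mul_Gamma_eq_betaIntegral (s := u) (t := 1 - u)
      (by rw [hre]; linarith) (by rw [Complex.sub_re, hre, Complex.one_re]; linarith)
    rw [add_sub_cancel, Complex.Gamma_one, one_mul, Complex.Gamma_mul_Gamma_one_sub] at h
    rw [← h, ← Complex.sin_add_pi_div_two, hu]
    ring_nf
  have himage : (fun t : ℝ ↦ sigmoid (2 * t)) '' Set.univ = Set.Ioo 0 1 := by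
    rw [Set.image_univ, ← range_sigmoid]
    exact (mul_left_surjective₀ (two_ne_zero' ℝ)).range_comp sigmoid
  have hderiv (t : ℝ) : HasDerivAt (fun t : ℝ ↦ sigmoid (2 * t))
      (sigmoid (2 * t) * (1 - sigmoid (2 * t)) * 2) t := by
    have h : HasDerivAt (fun t : ℝ ↦ 2 * t) 2 t := by simpa using (hasDerivAt_id t).const_mul 2
    exact (hasDerivAt_sigmoid (2 * t)).comp t h
  rw [← hbeta, Complex.betaIntegral, intervalIntegral.integral_of_le zero_le_one,
    integral_Ioc_eq_integral_Ioo, ← himage, integral_image_eq_integral_abs_deriv_smul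
      MeasurableSet.univ (fun t _ ↦ (hderiv t).hasDerivWithinAt)
      (sigmoid_injective.comp (mul_right_injective₀ two_ne_zero)).injOn, setIntegral_univ]
  congr 1 with t
  have hcosh : 0 < 2 * cosh t := by positivity [cosh_pos t]
  have h₂ : 1 - sigmoid (2 * t) = exp (-t - log (2 * cosh t)) := by
    rw [← sigmoid_neg, ← mul_neg, sigmoid_two_mul, cosh_neg]
  have hcpow (r : ℝ) (w : ℂ) : ((exp r : ℝ) : ℂ) ^ w = Complex.exp (r * w) := by
    rw [Complex.cpow_def_of_ne_zero (by exact_mod_cast (exp_pos r).ne'), ← Complex.ofReal_log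
      (exp_pos r).le, log_exp]
  have hinv : ((cosh t)⁻¹ : ℝ) = exp (-log (2 * cosh t)) * 2 := by
    rw [exp_neg, exp_log hcosh]; field_simp
  rw [hinv, ← Complex.ofReal_one, ← Complex.ofReal_sub, h₂, sigmoid_two_mul, hcpow, hcpow,
    abs_of_pos (by positivity), Complex.real_smul]
  push_cast
  rw [mul_right_comm _ (2 : ℂ), ← Complex.exp_add, ← Complex.exp_add, ← Complex.exp_add,
    ← mul_assoc, ← Complex.exp_add, hu]
  ring_nf

/-- The exponent `-i s / π` along the line `s = t + i π / 2`. -/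
def lineRate (t : ℝ) : ℂ := 1 / 2 - t / π * Complex.I

lemma lineRate_re (t : ℝ) : (lineRate t).re = 1 / 2 := by
  simp [lineRate, Complex.div_re]

lemma continuous_lineRate : Continuous lineRate := by
  unfold lineRate; fun_prop

lemma half_le_norm_lineRate (t : ℝ) : 1 / 2 ≤ ‖lineRate t‖ := by
  simpa [lineRate_re] using Complex.abs_re_le_norm (lineRate t)

lemma lineRate_ne_zero (t : ℝ) : lineRate t ≠ 0 :=
  norm_pos_iff.1 (by linarith [half_le_norm_lineRate t])

/-- Superposition of the exponentials `x ↦ exp (lineRate t * x)` with density `g`. -/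
def expTransform (g : ℝ → ℂ) (x : ℝ) : ℂ := ∫ t, Complex.exp (lineRate t * x) * g t

lemma norm_exp_lineRate_mul (t x : ℝ) : ‖Complex.exp (lineRate t * x)‖ = exp (x / 2) := by
  rw [Complex.norm_exp, Complex.re_mul_ofReal, lineRate_re]; ring_nf

lemma norm_expTransform_le (g : ℝ → ℂ) (x : ℝ) :
    ‖expTransform g x‖ ≤ exp (1 / 2 * x) * ∫ t, ‖g t‖ := by
  refine (norm_integral_le_integral_norm _).trans_eq ?_
  simp_rw [norm_mul, norm_exp_lineRate_mul, integral_const_mul]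
  ring_nf

lemma integrable_exp_lineRate_mul {g : ℝ → ℂ} (hg : Integrable g) (x : ℝ) :
    Integrable fun t ↦ Complex.exp (lineRate t * x) * g t := by
  refine hg.bdd_mul (c := exp (x / 2)) ?_ (.of_forall fun t ↦ (norm_exp_lineRate_mul t x).le)
  exact (Complex.continuous_exp.comp
    (continuous_lineRate.mul continuous_const)).aestronglyMeasurable

lemma integrable_div_lineRate {g : ℝ → ℂ} (hg : Integrable g) :
    Integrable fun t ↦ g t / lineRate t := by
  simp_rw [div_eq_inv_mul]
  refine hg.bdd_mul (c := 2) ?_ (.of_forall fun t ↦ ?_)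
  · exact (continuous_lineRate.inv₀ lineRate_ne_zero).aestronglyMeasurable
  · rw [norm_inv]
    have := half_le_norm_lineRate t
    rw [inv_le_comm₀ (by linarith) two_pos]; linarith

lemma hasDerivAt_expTransform {g : ℝ → ℂ} (hg : Integrable g) (x : ℝ) :
    HasDerivAt (expTransform fun t ↦ g t / lineRate t) (expTransform g x) x := by
  refine (hasDerivAt_integral_of_dominated_loc_of_deriv_le (Metric.ball_mem_nhds x one_pos)
    (.of_forall fun y ↦ (integrable_exp_lineRate_mul (integrable_div_lineRate hg) y).1)
    (integrable_exp_lineRate_mul (integrable_div_lineRate hg) x)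
    (F' := fun y t ↦ Complex.exp (lineRate t * y) * g t)
    (integrable_exp_lineRate_mul hg x).1 (bound := fun t ↦ exp ((x + 1) / 2) * ‖g t‖)
    (.of_forall fun t y hy ↦ ?_) (hg.norm.const_mul _) (.of_forall fun t y _ ↦ ?_)).2
  · rw [norm_mul, norm_exp_lineRate_mul]
    have : y < x + 1 := by
      have := (abs_lt.1 (Metric.mem_ball.1 hy)).2
      linarith
    gcongr
  · have h := ((((hasDerivAt_id (y : ℂ)).const_mul (lineRate t)).cexp.comp_ofReal).mul_const
      (g t / lineRate t))
    have hval : Complex.exp (lineRate t * y) * g t =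
        Complex.exp (lineRate t * y) * (lineRate t * 1) * (g t / lineRate t) := by
      have := lineRate_ne_zero t
      field_simp
    rw [hval]
    exact h

lemma integral_Iic_expTransform {g : ℝ → ℂ} (hg : Integrable g) (hg' : Continuous (expTransform g))
    (x : ℝ) :
    ∫ y in Set.Iic x, expTransform g y = expTransform (fun t ↦ g t / lineRate t) x := by
  rw [integral_Iic_of_hasDerivAt_of_tendsto' (m := 0) (fun y _ ↦ hasDerivAt_expTransform hg y),
    sub_zero]
  · refine ((integrableOn_exp_mul_Iic (one_half_pos) x).mul_const (∫ t, ‖g t‖)).mono'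
      hg'.aestronglyMeasurable (.of_forall fun y ↦ norm_expTransform_le g y)
  · refine squeeze_zero_norm (norm_expTransform_le _) ?_
    have : Filter.Tendsto (fun y : ℝ ↦ exp (1 / 2 * y)) Filter.atBot (nhds 0) :=
      tendsto_exp_atBot.comp (Filter.tendsto_id.const_mul_atBot one_half_pos)
    simpa using this.mul_const _

lemma expTransform_inv_cosh (x : ℝ) :
    expTransform (fun t ↦ ((cosh t)⁻¹ : ℝ)) x = (2 * π * sigmoid x : ℝ) := by
  have h := integral_exp_mul_inv_cosh (c := -(x / π) * Complex.I) (by simp [Complex.div_im])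
  have hpi : (π : ℂ) ≠ 0 := by exact_mod_cast pi_ne_zero
  have hcos : Complex.cos (π * (-(x / π) * Complex.I) / 2) = (cosh (x / 2) : ℝ) := by
    rw [Complex.ofReal_cosh, ← Complex.cos_mul_I, ← Complex.cos_neg]
    congr 1
    push_cast
    field_simp
  rw [hcos] at h
  have hsig : sigmoid x = exp (x / 2) / (2 * cosh (x / 2)) := by
    have hc : 0 < 2 * cosh (x / 2) := by positivity [cosh_pos (x / 2)]
    conv_lhs => rw [show x = 2 * (x / 2) by ring, sigmoid_two_mul, exp_sub, exp_log hc]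
  calc expTransform (fun t ↦ ((cosh t)⁻¹ : ℝ)) x
      = ∫ t : ℝ, Complex.exp (x / 2) *
          (Complex.exp (-(x / π) * Complex.I * t) * ((cosh t)⁻¹ : ℝ)) := by
        unfold expTransform
        congr 1 with t
        rw [← mul_assoc, ← Complex.exp_add, lineRate]
        ring_nf
    _ = _ := by
        rw [integral_const_mul, h, hsig]
        push_cast
        ring

lemma integral_Iic_sigmoid (x : ℝ) : ∫ y in Set.Iic x, sigmoid y = log (1 + exp x) := by
  have hd (y : ℝ) : HasDerivAt (fun y ↦ log (1 + exp y)) (sigmoid y) y := by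
    convert ((hasDerivAt_exp y).const_add 1).log (by positivity) using 1
    rw [sigmoid_def, exp_neg]
    field_simp
    ring
  rw [integral_Iic_of_hasDerivAt_of_tendsto' (m := 0) (fun y _ ↦ hd y), sub_zero]
  · refine (integrableOn_exp_Iic x).mono' continuous_sigmoid.aestronglyMeasurable
      (.of_forall fun y ↦ ?_)
    rw [norm_of_nonneg (sigmoid_nonneg y), sigmoid_def, exp_neg]
    exact inv_le_of_inv_le₀ (exp_pos y) (by linarith)
  · have h := (tendsto_exp_atBot.const_add 1).log (by norm_num)
    simpa using h

/-- `Li₂(-eˣ)` as an integral along the line `ℝ + i π / 2`. -/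
lemma integral_Iic_log_one_add_exp (x : ℝ) :
    expTransform (fun t ↦ ((cosh t)⁻¹ : ℝ) / lineRate t / lineRate t) x =
      (2 * π * ∫ y in Set.Iic x, log (1 + exp y) : ℝ) := by
  have h₀ : Integrable fun t : ℝ ↦ (((cosh t)⁻¹ : ℝ) : ℂ) := integrable_inv_cosh.ofReal
  have h₁ (y : ℝ) : expTransform (fun t ↦ ((cosh t)⁻¹ : ℝ) / lineRate t) y =
      (2 * π * log (1 + exp y) : ℝ) := by
    rw [← integral_Iic_expTransform h₀]
    · simp_rw [expTransform_inv_cosh, integral_complex_ofReal, integral_const_mul,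
        integral_Iic_sigmoid]
    · simp_rw [funext expTransform_inv_cosh]
      exact Complex.continuous_ofReal.comp (continuous_const.mul continuous_sigmoid)
  rw [← integral_Iic_expTransform (integrable_div_lineRate h₀)]
  · simp_rw [h₁, integral_complex_ofReal, integral_const_mul]
  · exact continuous_iff_continuousAt.2 fun y ↦ (hasDerivAt_expTransform h₀ y).continuousAt

lemma Phi_of_im_eq_zero {b : ℝ} (hb : 0 < b) {z : ℂ} (hz : z.im = 0) : Phi b z = PhiS b z := by
  have : 0 < (b + b⁻¹) / 2 := by positivity
  rw [Phi, hz, if_neg (by linarith), if_neg (by linarith)]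

/-- The integrand of `PhiS b (x / (2 π b))` after rescaling the contour to `ℝ + i π / 2`. -/
lemma integral_phiKer_eq {b : ℝ} (hb : 0 < b) (hb1 : b ≤ 1) (x : ℝ) :
    ∫ t : ℝ, phiKer b ((x / (2 * π * b) : ℝ) : ℂ) (t + Complex.I * (π * min b b⁻¹ / 2)) =
      ∫ t : ℝ, Complex.exp (lineRate t * x) * (((cosh t)⁻¹ : ℝ) *
        (-(4 * π * lineRate t)⁻¹ * (Complex.sinh (b ^ 2 * (π * lineRate t * Complex.I)))⁻¹)) := by
  have hmin : min b b⁻¹ = b := min_eq_left (hb1.trans (one_le_inv_iff₀.2 ⟨hb, hb1⟩))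
  have hbC : (b : ℂ) ≠ 0 := by exact_mod_cast hb.ne'
  have hpi : (π : ℂ) ≠ 0 := by exact_mod_cast pi_ne_zero
  rw [hmin]
  have hscale := Measure.integral_comp_mul_left
    (fun t : ℝ ↦ phiKer b ((x / (2 * π * b) : ℝ) : ℂ) (t + Complex.I * (π * b / 2))) b
  rw [abs_of_pos (inv_pos.2 hb), eq_inv_smul_iff₀ hb.ne', ← integral_smul] at hscale
  rw [← hscale]
  congr 1 with t
  have hline : ((b * t : ℝ) : ℂ) + Complex.I * (π * b / 2) = b * (π * lineRate t * Complex.I) := by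
    rw [lineRate]
    push_cast
    field_simp
    linear_combination (2 * t : ℂ) * Complex.I_sq
  have hsinh : Complex.sinh (π * lineRate t * Complex.I) = Complex.I * (cosh t : ℝ) := by
    rw [show (π * lineRate t * Complex.I : ℂ) = t + π / 2 * Complex.I from ?_, Complex.sinh_add,
      Complex.sinh_mul_I, Complex.cosh_mul_I, Complex.sin_pi_div_two, Complex.cos_pi_div_two,
      Complex.ofReal_cosh]
    · ring
    · rw [lineRate]
      field_simp
      linear_combination -(t : ℂ) * 2 * Complex.I_sq
  have hexp : (-2 * Complex.I * ((x / (2 * π * b) : ℝ) : ℂ) * (b * (π * lineRate t * Complex.I)))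
      = lineRate t * x := by
    push_cast
    field_simp
    linear_combination -(x * lineRate t) * Complex.I_sq
  have hcosh : ((cosh t : ℝ) : ℂ) ≠ 0 := by exact_mod_cast (cosh_pos t).ne'
  have hrate := lineRate_ne_zero t
  simp only [phiKer]
  rw [hline, hexp, mul_div_cancel_left₀ _ hbC, hsinh, Complex.real_smul,
    show (b * (π * lineRate t * Complex.I) * b : ℂ) = b ^ 2 * (π * lineRate t * Complex.I) by ring]
  generalize Complex.sinh (b ^ 2 * (π * lineRate t * Complex.I)) = S
  rw [div_eq_mul_inv]
  simp only [mul_inv, Complex.ofReal_inv, Complex.inv_I]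
  field_simp
  linear_combination S⁻¹ * Complex.I_sq

lemma norm_integral_phiKer_sub_le {b : ℝ} (hb : 0 < b) (hb1 : b ≤ 1) (x : ℝ) :
    ‖(∫ t : ℝ, phiKer b ((x / (2 * π * b) : ℝ) : ℂ) (t + Complex.I * (π * min b b⁻¹ / 2))) -
        (Li2negExp x : ℂ) / (2 * π * Complex.I * b ^ 2)‖ ≤
      3 / 4 * exp (x / 2) * (∫ t, (cosh t)⁻¹) * b ^ 2 := by
  have hbC : (b : ℂ) ≠ 0 := by exact_mod_cast hb.ne'
  have hpi : (π : ℂ) ≠ 0 := by exact_mod_cast pi_ne_zero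
  set K : ℝ → ℂ := fun t ↦ Complex.exp (lineRate t * x) * (((cosh t)⁻¹ : ℝ) *
    (-(4 * π * lineRate t)⁻¹ * (Complex.sinh (b ^ 2 * (π * lineRate t * Complex.I)))⁻¹)) with hK
  set K₀ : ℝ → ℂ := fun t ↦ Complex.exp (lineRate t * x) * (((cosh t)⁻¹ : ℝ) *
    (-(4 * π * lineRate t)⁻¹ * (b ^ 2 * (π * lineRate t * Complex.I))⁻¹)) with hK₀
  have hK₀_eq : K₀ = fun t ↦ Complex.I / (4 * π ^ 2 * b ^ 2) *
      (Complex.exp (lineRate t * x) * (((cosh t)⁻¹ : ℝ) / lineRate t / lineRate t)) := by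
    ext t
    have := lineRate_ne_zero t
    simp only [hK₀, mul_inv, Complex.inv_I]
    field_simp
  have hK₀_int : Integrable K₀ := by
    rw [hK₀_eq]
    exact (integrable_exp_lineRate_mul (integrable_div_lineRate (integrable_div_lineRate
      integrable_inv_cosh.ofReal)) x).const_mul _
  have hK₀_val : ∫ t, K₀ t = (Li2negExp x : ℂ) / (2 * π * Complex.I * b ^ 2) := by
    have h := integral_Iic_log_one_add_exp x
    rw [expTransform] at h
    rw [hK₀_eq, integral_const_mul, h, Li2negExp]
    push_cast
    field_simp
    linear_combination
      (4 * ((∫ y in Set.Iic x, log (1 + exp y) : ℝ) : ℂ)) * Complex.I_sq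
  have hbound (t : ℝ) : ‖K t - K₀ t‖ ≤ 3 / 4 * exp (x / 2) * b ^ 2 * (cosh t)⁻¹ := by
    have hrate := lineRate_ne_zero t
    have hrate' : 0 < ‖lineRate t‖ := norm_pos_iff.2 hrate
    have him : ((b : ℂ) ^ 2 * (π * lineRate t * Complex.I)).im = b ^ 2 * (π / 2) := by
      rw [← Complex.ofReal_pow, Complex.im_ofReal_mul, Complex.mul_I_im, Complex.re_ofReal_mul,
        lineRate_re]
      ring
    have h := Complex.norm_inv_sinh_sub_inv_le (u := b ^ 2 * (π * lineRate t * Complex.I))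
      (by simp [hbC, hpi, hrate]) (by
        rw [him, abs_of_pos (by positivity)]
        exact mul_le_of_le_one_left (by positivity) (pow_le_one₀ hb.le hb1))
    have hnorm : ‖(b : ℂ) ^ 2 * (π * lineRate t * Complex.I)‖ = b ^ 2 * (π * ‖lineRate t‖) := by
      simp [abs_of_pos hb, abs_of_pos pi_pos]
    rw [hnorm] at h
    have hcosh := cosh_pos t
    simp only [hK, hK₀]
    rw [← mul_sub, ← mul_sub, ← mul_sub, norm_mul, norm_mul, norm_mul, norm_exp_lineRate_mul,
      Complex.norm_real, norm_of_nonneg (by positivity), norm_neg, norm_inv, norm_mul, norm_mul,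
      Complex.norm_ofNat, Complex.norm_real, norm_of_nonneg pi_pos.le]
    calc _ ≤ exp (x / 2) * ((cosh t)⁻¹ * ((4 * π * ‖lineRate t‖)⁻¹ *
          (3 * (b ^ 2 * (π * ‖lineRate t‖))))) := by gcongr
      _ = _ := by field_simp
  have hmeas : Measurable K := by
    have := continuous_lineRate.measurable
    have := continuous_cosh.measurable
    simp only [hK]
    fun_prop
  have hbound_int := integrable_inv_cosh.const_mul (3 / 4 * exp (x / 2) * b ^ 2)
  have hsub_int : Integrable fun t ↦ K t - K₀ t :=
    hbound_int.mono' (hmeas.aestronglyMeasurable.sub hK₀_int.1) (.of_forall hbound)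
  have hK_int : Integrable K := by
    simpa [Pi.add_def] using hsub_int.add hK₀_int
  rw [integral_phiKer_eq hb hb1, ← hK₀_val, ← integral_sub hK_int hK₀_int]
  refine (norm_integral_le_of_norm_le hbound_int (.of_forall hbound)).trans_eq ?_
  rw [integral_const_mul]
  ring

/-- Quasi-classical limit of Faddeev's quantum dilogarithm (eq. (76) of the paper):
`Φ_𝖻(x/(2π𝖻)) = exp(Li₂(-eˣ)/(2πi𝖻²)) (1 + O(𝖻²))` as `𝖻 → 0⁺`, for each fixed real `x`. -/
theorem Phi_quasiclassical (x : ℝ) :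
    ∃ C > (0:ℝ), ∃ δ > (0:ℝ), ∀ bb : ℝ, 0 < bb → bb < δ →
      ‖Phi bb ((x / (2 * π * bb) : ℝ) : ℂ) *
          Complex.exp (-(Li2negExp x : ℂ) / (2 * π * Complex.I * bb ^ 2)) - 1‖ ≤ C * bb ^ 2 := by
  set M : ℝ := 3 / 4 * exp (x / 2) * ∫ t, (cosh t)⁻¹ with hM
  have hM0 : 0 ≤ M := mul_nonneg (by positivity) (integral_nonneg fun t ↦ (inv_pos.2 (cosh_pos t)).le)
  refine ⟨2 * M + 1, by positivity, min 1 (M + 1)⁻¹, by positivity, fun bb hb hlt ↦ ?_⟩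
  obtain ⟨hb1, hbM⟩ := lt_min_iff.1 hlt
  have hE := norm_integral_phiKer_sub_le hb hb1.le x
  rw [← hM] at hE
  rw [Phi_of_im_eq_zero hb (Complex.ofReal_im _), PhiS, ← Complex.exp_add, neg_div, ← sub_eq_add_neg]
  have hsmall : M * bb ^ 2 ≤ 1 := by
    have h1 : bb * (M + 1) < 1 := by rwa [← lt_div_iff₀ (by positivity), one_div]
    nlinarith
  refine (Complex.norm_exp_sub_one_le (hE.trans hsmall)).trans ?_
  nlinarith [sq_nonneg bb]
end
end
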